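/- Let X be a first countable, locally compact, paracompact Hausdorff topological space and let f : X → X be a topologically Anosov homeomorphism. Then the set Per(f) of periodic points of f is dense in the chain recurrent set CR(f). -/

import Mathlib

open Set Topology

namespace TopAnosovPaper

variable {X Y : Type*}

section Defs

variable [TopologicalSpace X]

/-- The `n`-th iterate (n ∈ ℤ) of a homeomorphism, as a function. -/
def iter (f : X ≃ₜ X) (n : ℤ) : X → X := ⇑(f.toEquiv ^ n)

/-- `N` is an expansive neighborhood for `f`: a closed neighborhood of the
diagonal such that any two distinct points are eventually separated by `F = f × f`. -/
def IsExpansiveNbhd (f : X ≃ₜ X) (N : Set (X × X)) : Prop :=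
  IsClosed N ∧ N ∈ nhdsSet (Set.diagonal X) ∧
    ∀ x y : X, x ≠ y → ∃ n : ℤ, (iter f n x, iter f n y) ∉ N

/-- `f` is topologically expansive. -/
def TopExpansive (f : X ≃ₜ X) : Prop := ∃ N : Set (X × X), IsExpansiveNbhd f N

/-- A `D`-pseudo-orbit: a bi-infinite sequence with `(f x_{i-1}, x_i) ∈ D`. -/
def IsPseudoOrbit (f : X ≃ₜ X) (D : Set (X × X)) (x : ℤ → X) : Prop :=
  ∀ i : ℤ, (f (x (i - 1)), x i) ∈ D

/-- `y` `E`-traces the bi-infinite sequence `x`. -/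
def Traces (f : X ≃ₜ X) (E : Set (X × X)) (y : X) (x : ℤ → X) : Prop :=
  ∀ i : ℤ, (iter f i y, x i) ∈ E

/-- `f` has the topological shadowing property. -/
def TopShadowing (f : X ≃ₜ X) : Prop :=
  ∀ E ∈ nhdsSet (Set.diagonal X), ∃ D ∈ nhdsSet (Set.diagonal X),
    ∀ x : ℤ → X, IsPseudoOrbit f D x → ∃ y : X, Traces f E y x

/-- `f` is topologically Anosov: expansive with the shadowing property. -/
def TopAnosov (f : X ≃ₜ X) : Prop := TopExpansive f ∧ TopShadowing f

/-- An `A`-chain from `x` to `y` (of length `n ≥ 1`). -/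
def IsChainFromTo (f : X ≃ₜ X) (A : Set (X × X)) (x y : X) : Prop :=
  ∃ n : ℕ, 1 ≤ n ∧ ∃ c : ℕ → X, c 0 = x ∧ c n = y ∧
    ∀ i : ℕ, 1 ≤ i → i ≤ n → (f (c (i - 1)), c i) ∈ A

/-- `x ∼ y`: for every neighborhood `A` of the diagonal there is an `A`-chain
from `x` to `y` and one from `y` to `x`. -/
def ChainRel (f : X ≃ₜ X) (x y : X) : Prop :=
  ∀ A ∈ nhdsSet (Set.diagonal X), IsChainFromTo f A x y ∧ IsChainFromTo f A y x

/-- The chain recurrent set. -/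
def CR (f : X ≃ₜ X) : Set X := {x | ChainRel f x x}

/-- `R` is a chain component: an equivalence class of `∼` restricted to `CR f`. -/
def IsChainComponent (f : X ≃ₜ X) (R : Set X) : Prop :=
  ∃ x ∈ CR f, R = {y | y ∈ CR f ∧ ChainRel f x y}

/-- The non-wandering set of `f`. -/
def NonWandering (f : X ≃ₜ X) : Set X :=
  {x | ∀ G : Set X, IsOpen G → x ∈ G → ∃ n : ℕ, 0 < n ∧ (iter f n '' G ∩ G).Nonempty}

/-- `x` is a periodic point of `f`. -/
def Periodic (f : X ≃ₜ X) (x : X) : Prop := ∃ n : ℕ, 0 < n ∧ iter f n x = x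

/-- The set of periodic points of `f`. -/
def Per (f : X ≃ₜ X) : Set X := {x | Periodic f x}

/-- A relation `M ⊆ X × X` is proper if `M[S]` is compact for every compact `S`. -/
def IsProperRel (M : Set (X × X)) : Prop :=
  ∀ S : Set X, IsCompact S → IsCompact {y : X | ∃ x ∈ S, (x, y) ∈ M}

/-- A set `U ⊆ X × X` is wide if `U ∪ (S × X) = X × X` for some compact `S`. -/
def IsWide (U : Set (X × X)) : Prop :=
  ∃ S : Set X, IsCompact S ∧ U ∪ (S ×ˢ (Set.univ : Set X)) = Set.univ

/-- `E` is symmetric. -/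
def SymmRel (E : Set (X × X)) : Prop := ∀ p : X × X, p ∈ E → (p.2, p.1) ∈ E

/-- `E² = {(x,y) : ∃ z, (x,z) ∈ E ∧ (z,y) ∈ E}`. -/
def sq (E : Set (X × X)) : Set (X × X) := {p : X × X | ∃ z : X, (p.1, z) ∈ E ∧ (z, p.2) ∈ E}

/-- The local stable set of `x` relative to `B`. -/
def WsLoc (f : X ≃ₜ X) (B : Set (X × X)) (x : X) : Set X :=
  {y | ∀ i : ℤ, 0 ≤ i → (iter f i x, iter f i y) ∈ B}

/-- The local unstable set of `x` relative to `B`. -/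
def WuLoc (f : X ≃ₜ X) (B : Set (X × X)) (x : X) : Set X :=
  {y | ∀ i : ℤ, i ≤ 0 → (iter f i x, iter f i y) ∈ B}

/-- The stable set of `x`. -/
def Ws (f : X ≃ₜ X) (x : X) : Set X :=
  {y | ∀ B ∈ nhdsSet (Set.diagonal X), ∃ n : ℕ, ∀ i : ℤ, (n : ℤ) ≤ i →
    (iter f i x, iter f i y) ∈ B}

/-- The unstable set of `x`. -/
def Wu (f : X ≃ₜ X) (x : X) : Set X :=
  {y | ∀ B ∈ nhdsSet (Set.diagonal X), ∃ n : ℕ, ∀ i : ℤ, i ≤ -(n : ℤ) →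
    (iter f i x, iter f i y) ∈ B}

/-- `f` restricted to `R` is topologically transitive: for any nonempty
relatively open subsets `G, H` of `R` there is `n ∈ ℕ` with `f^n(G) ∩ H ≠ ∅`. -/
def TransitiveOn (f : X ≃ₜ X) (R : Set X) : Prop :=
  ∀ G H : Set X, (∃ U : Set X, IsOpen U ∧ G = U ∩ R) → (∃ V : Set X, IsOpen V ∧ H = V ∩ R) →
    G.Nonempty → H.Nonempty → ∃ n : ℕ, (iter f n '' G ∩ H).Nonempty

/-- `V_N(A)`: pairs whose first `N` forward and backward iterates all lie in `A`. -/
def VN (f : X ≃ₜ X) (A : Set (X × X)) (N : ℕ) : Set (X × X) :=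
  {p : X × X | ∀ n : ℤ, |n| ≤ (N : ℤ) → (iter f n p.1, iter f n p.2) ∈ A}

/-- The `n`-th power (n ∈ ℕ) of a homeomorphism. -/
def hpowNat (f : X ≃ₜ X) : ℕ → X ≃ₜ X
  | 0 => Homeomorph.refl X
  | n + 1 => (hpowNat f n).trans f

/-- The `k`-th power (k ∈ ℤ) of a homeomorphism, as a homeomorphism. -/
def hpow (f : X ≃ₜ X) : ℤ → X ≃ₜ X
  | Int.ofNat n => hpowNat f n
  | Int.negSucc n => (hpowNat f (n + 1)).symm

end Defs

end TopAnosovPaper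

open TopAnosovPaper

namespace TopAnosovPaper

/-- In a paracompact Hausdorff space every neighborhood `N` of the diagonal contains `E ∘ E⁻¹` for
some neighborhood `E` of the diagonal. -/
theorem exists_mem_nhdsSet_diagonal_comp_subset {X : Type*} [TopologicalSpace X]
    [ParacompactSpace X] [T2Space X] {N : Set (X × X)} (hN : N ∈ nhdsSet (Set.diagonal X)) :
    ∃ E ∈ nhdsSet (Set.diagonal X), ∀ a b z : X, (a, z) ∈ E → (b, z) ∈ E → (a, b) ∈ N := by
  have hU : ∀ x : X, ∃ U : Set X, IsOpen U ∧ x ∈ U ∧ U ×ˢ U ⊆ N := by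
    intro x
    have hx : N ∈ 𝓝 (x, x) := mem_nhdsSet_iff_forall.1 hN (x, x) rfl
    obtain ⟨U, V, hUo, hxU, hVo, hxV, hUV⟩ := mem_nhds_prod_iff'.1 hx
    exact ⟨U ∩ V, hUo.inter hVo, ⟨hxU, hxV⟩, fun p hp => hUV ⟨hp.1.1, hp.2.2⟩⟩
  choose U hUo hxU hUN using hU
  obtain ⟨V, hVo, hVc, hVf, hVU⟩ :=
    precise_refinement U hUo (iUnion_eq_univ_iff.2 fun x => ⟨x, hxU x⟩)
  obtain ⟨F, hFc, hFcl, hFV⟩ :=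
    exists_iUnion_eq_closed_subset hVo (fun x => hVf.point_finite x) hVc
  have hlf : LocallyFinite fun i => (V i)ᶜ ×ˢ F i := by
    intro p
    obtain ⟨t, ht, hfin⟩ := hVf p.2
    refine ⟨Prod.snd ⁻¹' t, continuous_snd.continuousAt ht, hfin.subset ?_⟩
    rintro i ⟨q, hq, hqt⟩
    exact ⟨q.2, hFV i hq.2, hqt⟩
  have hclosed : IsClosed (⋃ i, (V i)ᶜ ×ˢ F i) :=
    hlf.isClosed_iUnion fun i => (hVo i).isClosed_compl.prod (hFcl i)
  refine ⟨(⋃ i, (V i)ᶜ ×ˢ F i)ᶜ, hclosed.isOpen_compl.mem_nhdsSet.2 ?_, ?_⟩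
  · rintro ⟨a, b⟩ hab hmem
    obtain rfl : a = b := hab
    obtain ⟨i, hi⟩ := mem_iUnion.1 hmem
    exact hi.1 (hFV i hi.2)
  · intro a b z ha hb
    obtain ⟨i, hi⟩ := iUnion_eq_univ_iff.1 hFc z
    have key : ∀ c : X, (c, z) ∈ (⋃ i, (V i)ᶜ ×ˢ F i)ᶜ → c ∈ V i := fun c hc => by
      by_contra h
      exact hc (mem_iUnion.2 ⟨i, h, hi⟩)
    exact hUN i ⟨hVU i (key a ha), hVU i (key b hb)⟩

theorem iter_add_apply {X : Type*} [TopologicalSpace X] (f : X ≃ₜ X) (m n : ℤ) (x : X) :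
    iter f (m + n) x = iter f m (iter f n x) := by
  simp [iter, zpow_add]

/-- A chain from a point to itself extends to a periodic pseudo-orbit. -/
theorem IsChainFromTo.exists_periodic_pseudoOrbit {X : Type*} [TopologicalSpace X] {f : X ≃ₜ X}
    {A : Set (X × X)} {x : X} (h : IsChainFromTo f A x x) :
    ∃ n : ℕ, 0 < n ∧ ∃ s : ℤ → X, s 0 = x ∧ (∀ i, s (i + n) = s i) ∧ IsPseudoOrbit f A s := by
  obtain ⟨n, hn, c, h0, hcn, hc⟩ := h
  refine ⟨n, hn, fun i => c (i % n).toNat, by simpa using h0, fun i => by simp, fun i => ?_⟩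
  have hn' : (0 : ℤ) < n := by omega
  obtain ⟨k, hk⟩ : ∃ k : ℕ, ((i - 1) % n) = k :=
    ⟨_, (Int.toNat_of_nonneg (Int.emod_nonneg _ hn'.ne')).symm⟩
  have hkn : k < n := by
    have := Int.emod_lt_of_pos (i - 1) hn'
    omega
  have hi : i % n = ((k + 1 : ℕ) : ℤ) % n := by
    have : i % n = ((i - 1) % n + 1) % n := by simp
    rw [this, hk]
    push_cast
    rfl
  have hstep := hc (k + 1) (by omega) (by omega)
  rw [Nat.add_sub_cancel] at hstep
  simp only [hk, hi, Int.toNat_natCast]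
  rcases (Nat.succ_le_of_lt hkn).lt_or_eq with h | h
  · rw [Int.emod_eq_of_lt (by positivity) (by exact_mod_cast h), Int.toNat_natCast]
    exact hstep
  · have h' : k + 1 = n := h
    rw [h'] at hstep ⊢
    rw [Int.emod_self, Int.toNat_zero, h0, ← hcn]
    exact hstep

end TopAnosovPaper

/-- The periodic points of a topologically Anosov homeomorphism are dense
in the chain recurrent set. -/
theorem per_dense_in_CR {X : Type*} [TopologicalSpace X]
    [FirstCountableTopology X] [LocallyCompactSpace X] [ParacompactSpace X] [T2Space X]
    (f : X ≃ₜ X) (hf : TopAnosov f) :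
    CR f ⊆ closure (Per f) := by
  obtain ⟨⟨N, -, hN, hexp⟩, hsh⟩ := hf
  intro x hx
  rw [mem_closure_iff]
  intro G hG hxG
  obtain ⟨E, hE, hEN⟩ := exists_mem_nhdsSet_diagonal_comp_subset hN
  have hB : (Gᶜ ×ˢ {x})ᶜ ∈ nhdsSet (Set.diagonal X) := by
    refine (hG.isClosed_compl.prod isClosed_singleton).isOpen_compl.mem_nhdsSet.2 ?_
    rintro ⟨a, b⟩ hab ⟨ha, hb⟩
    obtain rfl : a = b := hab
    obtain rfl : a = x := hb
    exact ha hxG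
  obtain ⟨D, hD, hDtr⟩ := hsh _ (Filter.inter_mem hE hB)
  obtain ⟨n, hn, s, hs0, hsn, hs⟩ := (hx D hD).1.exists_periodic_pseudoOrbit
  obtain ⟨y, hy⟩ := hDtr s hs
  refine ⟨y, ?_, n, hn, ?_⟩
  · by_contra h
    have hy0 := (hy 0).2
    rw [hs0] at hy0
    exact hy0 ⟨by simpa [iter] using h, rfl⟩
  · by_contra h
    obtain ⟨m, hm⟩ := hexp _ _ h
    refine hm (hEN _ _ (s m) ?_ (hy m).1)
    rw [← iter_add_apply, ← hsn m]
    exact (hy (m + n)).1
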